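/- For all c, d ∈ ℝ⟨⟨X⟩⟩ and all z ∈ G, the mixed composition product distributes over the shuffle product on the left: (c ⧢ d) ◁ z = (c ◁ z) ⧢ (d ◁ z). -/

import Mathlib

open scoped Classical

/-!  Common setup: noncommutative formal power series ℝ⟨⟨X⟩⟩ over the
alphabet X = {x₀, x₁}.  Words are encoded as lists over `Fin 2`
(the letter `0` is x₀ and `1` is x₁); a series is a function from words
to ℝ, recording its coefficients. -/

/-- Words over the alphabet X = {x₀, x₁}. -/
abbrev Word : Type := List (Fin 2)

/-- Noncommutative formal power series ℝ⟨⟨X⟩⟩. -/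
abbrev Ser : Type := Word → ℝ

/-- The series 𝟙 (the empty word). -/
def one1 : Ser := fun w => if w = [] then 1 else 0

/-- A single word η regarded as a series. -/
def mono (η : Word) : Ser := fun w => if w = η then 1 else 0

/-- Left concatenation of a series by the letter `x_i`. -/
def lc (i : Fin 2) (c : Ser) : Ser := fun w =>
  match w with
  | [] => 0
  | j :: u => if j = i then c u else 0

/-- Auxiliary recursion computing the coefficient of a word `w` in `c ⧢ d`:
`(c ⧢ d)(𝟙) = c(𝟙) d(𝟙)` and
`(c ⧢ d)(x_i w) = ((x_i⁻¹ c) ⧢ d)(w) + (c ⧢ (x_i⁻¹ d))(w)`,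
where `x_i⁻¹` is the left shift.  This dual recursion is exactly the
bilinear extension of the inductive shuffle of words
`(x_i ξ) ⧢ (x_j η) = x_i (ξ ⧢ x_j η) + x_j (x_i ξ ⧢ η)`, `𝟙 ⧢ η = η ⧢ 𝟙 = η`. -/
def shAux : Word → Ser → Ser → ℝ
  | [], c, d => c [] * d []
  | i :: w, c, d => shAux w (fun u => c (i :: u)) d + shAux w c (fun u => d (i :: u))

/-- The shuffle product `⧢` on ℝ⟨⟨X⟩⟩. -/
def sh (c d : Ser) : Ser := fun w => shAux w c d

/-- Shuffle powers `c^{⧢ k}`. -/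
def shPow (c : Ser) : ℕ → Ser
  | 0 => one1
  | k + 1 => sh c (shPow c k)

/-- The shuffle inverse `c^{⧢ -1} = Σ_{k ≥ 0} (𝟙 - c)^{⧢ k}`.
When `c(𝟙) = 1` the sum is locally finite (for each word only finitely many
terms are nonzero) and `∑'` returns it. -/
noncomputable def shInv (c : Ser) : Ser := fun w => ∑' k : ℕ, shPow (one1 - c) k w

/-- Composition product restricted to words: `𝟙 ∘ d = 𝟙`,
`(x₀ η) ∘ d = x₀ (η ∘ d)`, `(x₁ η) ∘ d = x₀ (d ⧢ (η ∘ d))`. -/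
def wordComp : Word → Ser → Ser
  | [], _ => one1
  | i :: η, d => if i = 0 then lc 0 (wordComp η d) else lc 0 (sh d (wordComp η d))

/-- The composition product `c ∘ d = Σ_η c(η) (η ∘ d)`.  For each fixed word
only finitely many terms are nonzero, and `∑'` returns the sum. -/
noncomputable def comp (c d : Ser) : Ser := fun w => ∑' η : Word, c η * wordComp η d w

/-- Membership in the set `G`: pairs `(d₁, d₂)` with `d₁(𝟙) = 1`. -/
def inG (d : Ser × Ser) : Prop := d.1 [] = 1

/-- Mixed composition product restricted to words: `𝟙 ◁ d = 𝟙`,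
`(x₀ η) ◁ d = x₀ (η ◁ d)`,
`(x₁ η) ◁ d = x₁ (d₁ ⧢ (η ◁ d)) + x₀ (d₂ ⧢ (η ◁ d))`. -/
def wordMComp : Word → Ser × Ser → Ser
  | [], _ => one1
  | i :: η, d =>
      if i = 0 then lc 0 (wordMComp η d)
      else lc 1 (sh d.1 (wordMComp η d)) + lc 0 (sh d.2 (wordMComp η d))

/-- The mixed composition product `c ◁ d = Σ_η c(η) (η ◁ d)`. -/
noncomputable def mcomp (c : Ser) (d : Ser × Ser) : Ser :=
  fun w => ∑' η : Word, c η * wordMComp η d w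

/-- Componentwise mixed composition `c ⊲ d = (c₁ ◁ d, c₂ ◁ d)`. -/
noncomputable def tri (c d : Ser × Ser) : Ser × Ser := (mcomp c.1 d, mcomp c.2 d)

/-- Componentwise composition `d ∘̄ c = (d₁ ∘ c, d₂ ∘ c)`. -/
noncomputable def bcomp (d : Ser × Ser) (c : Ser) : Ser × Ser := (comp d.1 c, comp d.2 c)

/-- The group product `⊙` on `G`:
`(c₁, c₂) ⊙ (d₁, d₂) = (c₁ ⧢ d₁, c₂ + d₂ ⧢ c₁)`. -/
def odot (c d : Ser × Ser) : Ser × Ser := (sh c.1 d.1, c.2 + sh d.2 c.1)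

/-- The identity element `e = (𝟙, 0)`. -/
def eG : Ser × Ser := (one1, 0)

/-- The `⊙`-inverse `c^{⊙ -1} = (c₁^{⧢ -1}, -(c₁^{⧢ -1} ⧢ c₂))`. -/
noncomputable def odotInv (c : Ser × Ser) : Ser × Ser :=
  (shInv c.1, -(sh (shInv c.1) c.2))

/-- The affine feedback group product `c ⋆ d = (c ⊲ d) ⊙ d` on `G`. -/
noncomputable def star (c d : Ser × Ser) : Ser × Ser := odot (tri c d) d

/-- The `⋆`-inverse of an element of `G` (defined via choice; for an element
of the group `(G, ⋆)` it is the unique two-sided `⋆`-inverse). -/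
noncomputable def starInv (x : Ser × Ser) : Ser × Ser :=
  if h : ∃ y : Ser × Ser, inG y ∧ star x y = eG ∧ star y x = eG then h.choose else x

/-- The affine feedback product `c @ d = c ◁ ((d^{⊙ -1}) ∘̄ c)^{⋆ -1}`. -/
noncomputable def atp (c : Ser) (d : Ser × Ser) : Ser :=
  mcomp c (starInv (bcomp (odotInv d) c))

/-- Membership in ℝ[[x₀]]: series vanishing on every word containing x₁. -/
def inRx0 (c : Ser) : Prop := ∀ w : Word, (1 : Fin 2) ∈ w → c w = 0

/-- The left shift `x_i⁻¹ c`. -/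
def leftShift (i : Fin 2) (c : Ser) : Ser := fun u => c (i :: u)

theorem sh_nil (a b : Ser) : sh a b [] = a [] * b [] := rfl

theorem sh_cons (a b : Ser) (i : Fin 2) (w : Word) :
    sh a b (i :: w) = sh (leftShift i a) b w + sh a (leftShift i b) w := rfl

theorem leftShift_sh (i : Fin 2) (a b : Ser) :
    leftShift i (sh a b) = sh (leftShift i a) b + sh a (leftShift i b) := rfl

theorem leftShift_add (i : Fin 2) (a b : Ser) :
    leftShift i (a + b) = leftShift i a + leftShift i b := rfl

theorem leftShift_smul (i : Fin 2) (r : ℝ) (a : Ser) :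
    leftShift i (r • a) = r • leftShift i a := rfl

theorem sh_comm (a b : Ser) : sh a b = sh b a := by
  funext w
  induction w generalizing a b with
  | nil => simp only [sh_nil, mul_comm]
  | cons i w ih => rw [sh_cons, sh_cons, ih, ih a, add_comm]

theorem sh_add (a b c : Ser) : sh a (b + c) = sh a b + sh a c := by
  funext w
  induction w generalizing a b c with
  | nil => simp only [sh_nil, Pi.add_apply, mul_add]
  | cons i w ih =>
    simp only [Pi.add_apply, sh_cons, leftShift_add, ih]
    ring

theorem add_sh (a b c : Ser) : sh (a + b) c = sh a c + sh b c := by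
  rw [sh_comm, sh_add, sh_comm c a, sh_comm c b]

theorem sh_smul (r : ℝ) (a b : Ser) : sh a (r • b) = r • sh a b := by
  funext w
  induction w generalizing a b with
  | nil => simp only [sh_nil, Pi.smul_apply, smul_eq_mul]; ring
  | cons i w ih =>
    simp only [Pi.smul_apply, sh_cons, leftShift_smul, ih, smul_add]

theorem sh_assoc (a b c : Ser) : sh (sh a b) c = sh a (sh b c) := by
  funext w
  induction w generalizing a b c with
  | nil => simp only [sh_nil, mul_assoc]
  | cons i w ih =>
    simp only [sh_cons, leftShift_sh, sh_add, add_sh, Pi.add_apply, ih]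
    ring

theorem sh_left_comm (a b c : Ser) : sh a (sh b c) = sh b (sh a c) := by
  rw [← sh_assoc, sh_comm a b, sh_assoc]

/-- The shuffle product by a fixed left factor, as a linear map. -/
def shLinear (a : Ser) : Ser →ₗ[ℝ] Ser where
  toFun := sh a
  map_add' := sh_add a
  map_smul' r := sh_smul r a

theorem sh_sum_smul {ι : Type*} (s : Finset ι) (a : Ser) (r : ι → ℝ) (f : ι → Ser) :
    sh a (∑ j ∈ s, r j • f j) = ∑ j ∈ s, r j • sh a (f j) := by
  refine (map_sum (shLinear a) (fun j => r j • f j) s).trans ?_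
  exact Finset.sum_congr rfl fun j _ => sh_smul (r j) a (f j)

/-- A coefficient of `a ⧢ b` depends only on coefficients of words that are no longer. -/
theorem sh_congr_right {a b b' : Ser} {w : Word}
    (h : ∀ u : Word, u.length ≤ w.length → b u = b' u) : sh a b w = sh a b' w := by
  induction w generalizing a b b' with
  | nil => rw [sh_nil, sh_nil, h [] le_rfl]
  | cons i w ih =>
    rw [sh_cons, sh_cons, ih fun u hu => h u (hu.trans (Nat.le_succ _)),
      ih (b := leftShift i b) (b' := leftShift i b') fun u hu => h (i :: u) (Nat.succ_le_succ hu)]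

theorem sh_eq_zero_of_right {a b : Ser} {w : Word}
    (h : ∀ u : Word, u.length ≤ w.length → b u = 0) : sh a b w = 0 := by
  rw [sh_congr_right (b' := (0 : ℝ) • b) fun u hu => by simp [h u hu], sh_smul]
  simp

theorem wordMComp_cons_nil (i : Fin 2) (η : Word) (z : Ser × Ser) :
    wordMComp (i :: η) z [] = 0 := by
  rw [wordMComp]
  split_ifs <;> simp [lc]

theorem wordMComp_zero_cons_zero (η w : Word) (z : Ser × Ser) :
    wordMComp (0 :: η) z (0 :: w) = wordMComp η z w := by
  simp [wordMComp, lc]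

theorem wordMComp_zero_cons_one (η w : Word) (z : Ser × Ser) :
    wordMComp (0 :: η) z (1 :: w) = 0 := by
  simp [wordMComp, lc]

theorem wordMComp_one_cons_zero (η w : Word) (z : Ser × Ser) :
    wordMComp (1 :: η) z (0 :: w) = sh z.2 (wordMComp η z) w := by
  simp [wordMComp, lc]

theorem wordMComp_one_cons_one (η w : Word) (z : Ser × Ser) :
    wordMComp (1 :: η) z (1 :: w) = sh z.1 (wordMComp η z) w := by
  simp [wordMComp, lc]

theorem wordMComp_eq_zero {η w : Word} (z : Ser × Ser) (h : w.length < η.length) :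
    wordMComp η z w = 0 := by
  induction η generalizing w with
  | nil => simp at h
  | cons i η ih =>
    cases w with
    | nil => exact wordMComp_cons_nil i η z
    | cons j w =>
      have hlt : w.length < η.length := Nat.lt_of_succ_lt_succ h
      have hsh (a : Ser) : sh a (wordMComp η z) w = 0 :=
        sh_eq_zero_of_right fun u hu => ih (hu.trans_lt hlt)
      fin_cases i <;> fin_cases j
      · exact (wordMComp_zero_cons_zero η w z).trans (ih hlt)
      · exact wordMComp_zero_cons_one η w z
      · exact (wordMComp_one_cons_zero η w z).trans (hsh _)
      · exact (wordMComp_one_cons_one η w z).trans (hsh _)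

/-- The words of length at most `n`. -/
noncomputable def wordsLE (n : ℕ) : Finset Word := (List.finite_length_le (Fin 2) n).toFinset

theorem mem_wordsLE {n : ℕ} {η : Word} : η ∈ wordsLE n ↔ η.length ≤ n := by
  simp [wordsLE]

theorem wordsLE_succ (n : ℕ) :
    wordsLE (n + 1) = insert [] ((wordsLE n).image (List.cons 0) ∪
      (wordsLE n).image (List.cons 1)) := by
  ext η
  rcases η with _ | ⟨i, η⟩
  · simp [mem_wordsLE]
  · fin_cases i <;> simp [mem_wordsLE]

theorem sum_wordsLE_succ (n : ℕ) (f : Word → ℝ) :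
    ∑ η ∈ wordsLE (n + 1), f η =
      f [] + (∑ η ∈ wordsLE n, f (0 :: η) + ∑ η ∈ wordsLE n, f (1 :: η)) := by
  rw [wordsLE_succ, Finset.sum_insert (by simp), Finset.sum_union,
    Finset.sum_image (by simp), Finset.sum_image (by simp)]
  rw [Finset.disjoint_left]
  simp

theorem mcomp_apply_eq_sum (c : Ser) (z : Ser × Ser) {w : Word} {n : ℕ} (h : w.length ≤ n) :
    mcomp c z w = ∑ η ∈ wordsLE n, c η * wordMComp η z w :=
  tsum_eq_sum fun η hη => by
    rw [wordMComp_eq_zero z (h.trans_lt (not_le.mp (mt mem_wordsLE.mpr hη))), mul_zero]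

theorem sh_mcomp_apply (a c : Ser) (z : Ser × Ser) (w : Word) :
    sh a (mcomp c z) w = ∑ η ∈ wordsLE w.length, c η * sh a (wordMComp η z) w := by
  rw [sh_congr_right (b' := ∑ η ∈ wordsLE w.length, c η • wordMComp η z), sh_sum_smul]
  · simp
  · intro u hu
    simp [mcomp_apply_eq_sum c z hu]

theorem mcomp_nil (c : Ser) (z : Ser × Ser) : mcomp c z [] = c [] := by
  have h : wordsLE 0 = {[]} := by
    ext η
    simp [mem_wordsLE]
  rw [mcomp_apply_eq_sum c z (n := 0) le_rfl, h]
  simp [wordMComp, one1]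

theorem leftShift_zero_mcomp (c : Ser) (z : Ser × Ser) :
    leftShift 0 (mcomp c z) = mcomp (leftShift 0 c) z + sh z.2 (mcomp (leftShift 1 c) z) := by
  funext w
  rw [leftShift, mcomp_apply_eq_sum c z (n := w.length + 1) le_rfl, sum_wordsLE_succ,
    Pi.add_apply, sh_mcomp_apply, mcomp_apply_eq_sum _ z le_rfl]
  simp only [wordMComp_zero_cons_zero, wordMComp_one_cons_zero]
  simp [wordMComp, one1, leftShift]

theorem leftShift_one_mcomp (c : Ser) (z : Ser × Ser) :
    leftShift 1 (mcomp c z) = sh z.1 (mcomp (leftShift 1 c) z) := by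
  funext w
  rw [leftShift, mcomp_apply_eq_sum c z (n := w.length + 1) le_rfl, sum_wordsLE_succ,
    sh_mcomp_apply]
  simp only [wordMComp_zero_cons_one, wordMComp_one_cons_one]
  simp [wordMComp, one1, leftShift]

theorem mcomp_add (c d : Ser) (z : Ser × Ser) : mcomp (c + d) z = mcomp c z + mcomp d z := by
  funext w
  simp only [Pi.add_apply, mcomp_apply_eq_sum _ z (le_refl w.length), add_mul,
    Finset.sum_add_distrib]

theorem mcomp_sh_apply (c d : Ser) (z : Ser × Ser) (n : ℕ) (w : Word) (hw : w.length ≤ n) :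
    mcomp (sh c d) z w = sh (mcomp c z) (mcomp d z) w := by
  induction n generalizing c d w with
  | zero =>
    obtain rfl : w = [] := by simpa using hw
    simp only [mcomp_nil, sh_nil]
  | succ n ih =>
    rcases w with _ | ⟨i, w⟩
    · simp only [mcomp_nil, sh_nil]
    have hn : w.length ≤ n := Nat.le_of_succ_le_succ hw
    have hsh (a c d : Ser) :
        sh a (mcomp (sh c d) z) w = sh a (sh (mcomp c z) (mcomp d z)) w :=
      sh_congr_right fun u hu => ih c d u (hu.trans hn)
    change leftShift i (mcomp (sh c d) z) w = leftShift i (sh (mcomp c z) (mcomp d z)) w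
    obtain rfl | rfl : i = 0 ∨ i = 1 := by omega
    · simp only [leftShift_zero_mcomp, leftShift_sh, mcomp_add, sh_add, add_sh, Pi.add_apply,
        hsh, ih _ _ w hn, sh_assoc, sh_left_comm (mcomp c z) z.2]
      ring
    · simp only [leftShift_one_mcomp, leftShift_sh, mcomp_add, sh_add, Pi.add_apply,
        hsh, sh_assoc, sh_left_comm (mcomp c z) z.1]

/-- the mixed composition product distributes over the shuffle
product on the left: `(c ⧢ d) ◁ z = (c ◁ z) ⧢ (d ◁ z)` for all `z ∈ G`. -/
theorem mcomp_distrib_shuffle_left (c d : Ser) (z : Ser × Ser) (hz : inG z) :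
    mcomp (sh c d) z = sh (mcomp c z) (mcomp d z) :=
  funext fun w => mcomp_sh_apply c d z w.length w le_rfl
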